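/- Assume ∂_rV ∈ L^∞ and that r ↦ ∂_rV(r,v) is Lipschitz continuous uniformly in v. Then there exists a constant C independent of N such that the cut-off force satisfies the local Lipschitz estimate |F^N(x,v) − F^N(y,v)| ≤ q^N(x,v)·|x−y| for all x, y, v, where q^N(x,v) = C·(1/|x|) + C when |x| ≥ N^{−θ} and q^N(x,v) = C·N^θ when |x| < N^{−θ}. -/

import Mathlib

open MeasureTheory Real Set Filter Topology
open scoped ENNReal

noncomputable section

abbrev E2 : Type := EuclideanSpace ℝ (Fin 2)
abbrev Phase : Type := E2 × E2

/-- Convolution in phase space: `(F∗f)(z) = ∫ F(z-w) f(w) dw`. -/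
def pconv (F : Phase → E2) (f : Phase → ℝ) (z : Phase) : E2 :=
  ∫ w : Phase, f w • F (z - w)

/-- The interaction force `F(x,v) = ∂_rV(|x|,v) (x/|x|) 𝓗(x,v)`. -/
def force (V' : ℝ → E2 → ℝ) (HR Ht : ℝ → ℝ) (z : Phase) : E2 :=
  ((V' ‖z.1‖ z.2 * HR ‖z.1‖ * Ht ‖z.2‖) * ‖z.1‖⁻¹) • z.1

/-- The cut-off force `F^N`. -/
def forceN (V' : ℝ → E2 → ℝ) (HR Ht : ℝ → ℝ) (θ : ℝ) (N : ℕ) (z : Phase) : E2 :=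
  if (N : ℝ) ^ (-θ) ≤ ‖z.1‖ then force V' HR Ht z
  else (((N : ℝ) ^ θ * V' ‖z.1‖ z.2) * (HR ‖z.1‖ * Ht ‖z.2‖)) • z.1

/-- A continuous function that is constant on both sides of a compact interval is bounded. -/
theorem exists_abs_le_of_continuous_of_eq_off_Icc {f : ℝ → ℝ} (hf : Continuous f) {a b c d : ℝ}
    (hleft : ∀ s, s < a → f s = c) (hright : ∀ s, b < s → f s = d) :
    ∃ B, 0 ≤ B ∧ ∀ s, |f s| ≤ B := by
  obtain ⟨B, hB⟩ := (isCompact_Icc (a := a) (b := b)).exists_bound_of_continuousOn hf.continuousOn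
  have hc := abs_nonneg c
  have hd := abs_nonneg d
  have hB0 := abs_nonneg B
  refine ⟨|B| + |c| + |d|, by positivity, fun s => ?_⟩
  rcases lt_or_ge s a with h | h
  · rw [hleft s h]; linarith
  rcases lt_or_ge b s with h' | h'
  · rw [hright s h']; linarith
  · have := hB s ⟨h, h'⟩
    rw [Real.norm_eq_abs] at this
    linarith [le_abs_self B]

/-- A `C¹` function that is constant on both sides of a compact interval is Lipschitz. -/
theorem exists_lipschitz_of_contDiff_of_eq_off_Icc {f : ℝ → ℝ} (hf : ContDiff ℝ 1 f)
    {a b c d : ℝ} (hleft : ∀ s, s < a → f s = c) (hright : ∀ s, b < s → f s = d) :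
    ∃ K, 0 ≤ K ∧ ∀ s t, |f s - f t| ≤ K * |s - t| := by
  have hl : ∀ s, s < a → deriv f s = 0 := fun s hs => by
    have : f =ᶠ[𝓝 s] fun _ => c := (eventually_lt_nhds hs).mono hleft
    rw [this.deriv_eq, deriv_const]
  have hr : ∀ s, b < s → deriv f s = 0 := fun s hs => by
    have : f =ᶠ[𝓝 s] fun _ => d := (eventually_gt_nhds hs).mono hright
    rw [this.deriv_eq, deriv_const]
  obtain ⟨K, hK0, hK⟩ := exists_abs_le_of_continuous_of_eq_off_Icc
    (hf.continuous_deriv le_rfl) hl hr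
  refine ⟨K, hK0, fun s t => ?_⟩
  exact Convex.norm_image_sub_le_of_norm_deriv_le (s := Set.univ)
    (fun x _ => (hf.differentiable one_ne_zero) x) (fun x _ => hK x) convex_univ
    (Set.mem_univ t) (Set.mem_univ s)

/-- The truncated direction field `x ↦ x / max |x| δ` satisfies a local Lipschitz bound. -/
theorem norm_inv_max_smul_sub_le {E : Type*} [NormedAddCommGroup E] [NormedSpace ℝ E]
    {δ : ℝ} (hδ : 0 < δ) (x y : E) :
    ‖(max ‖x‖ δ)⁻¹ • x - (max ‖y‖ δ)⁻¹ • y‖ ≤ 2 * (max ‖x‖ δ)⁻¹ * ‖x - y‖ := by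
  have hx : 0 < max ‖x‖ δ := lt_max_of_lt_right hδ
  have hy : 0 < max ‖y‖ δ := lt_max_of_lt_right hδ
  have hmax : |max ‖y‖ δ - max ‖x‖ δ| ≤ ‖x - y‖ :=
    (abs_max_sub_max_le_abs _ _ _).trans
      ((abs_norm_sub_norm_le y x).trans_eq (norm_sub_rev y x))
  have hyle : (max ‖y‖ δ)⁻¹ * ‖y‖ ≤ 1 := by
    rw [inv_mul_le_one₀ hy]; exact le_max_left _ _
  generalize max ‖x‖ δ = p at *
  generalize max ‖y‖ δ = q at *
  have hsplit : p⁻¹ • x - q⁻¹ • y = p⁻¹ • (x - y) + (p⁻¹ * (q - p) * q⁻¹) • y := by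
    have : p⁻¹ * (q - p) * q⁻¹ = p⁻¹ - q⁻¹ := by field_simp
    rw [this]; module
  rw [hsplit]
  refine (norm_add_le _ _).trans ?_
  rw [norm_smul, norm_smul, norm_mul, norm_mul, norm_inv, norm_inv, Real.norm_eq_abs,
    Real.norm_eq_abs, Real.norm_eq_abs, abs_of_pos hx, abs_of_pos hy]
  have : p⁻¹ * |q - p| * (q⁻¹ * ‖y‖) ≤ p⁻¹ * ‖x - y‖ * 1 := by gcongr
  linarith

/-- The cut-off force is a radial profile times the truncated direction field. -/
theorem forceN_eq_smul (V' : ℝ → E2 → ℝ) (HR Ht : ℝ → ℝ) (θ : ℝ) (N : ℕ) (x v : E2) :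
    forceN V' HR Ht θ N (x, v) =
      (V' ‖x‖ v * (HR ‖x‖ * Ht ‖v‖)) • ((max ‖x‖ ((N : ℝ) ^ (-θ)))⁻¹ • x) := by
  unfold forceN force
  split_ifs with h
  · rw [max_eq_left h, smul_smul, mul_assoc (V' _ _)]
  · rw [max_eq_right (not_le.1 h).le, smul_smul, Real.rpow_neg N.cast_nonneg, inv_inv]
    congr 1
    ring

theorem statement5
    (R Rt : ℝ) (hR : 0 < R) (hRt : 0 < Rt)
    (HR Ht : ℝ → ℝ) (hHRs : ContDiff ℝ (⊤ : ℕ∞) HR) (hHts : ContDiff ℝ (⊤ : ℕ∞) Ht)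
    (hHR1 : ∀ s : ℝ, s < R → HR s = 1) (hHR0 : ∀ s : ℝ, 2 * R < s → HR s = 0)
    (hHt1 : ∀ s : ℝ, s < Rt → Ht s = 1) (hHt0 : ∀ s : ℝ, 2 * Rt < s → Ht s = 0)
    (θ : ℝ) (hθ : 0 < θ)
    (V' : ℝ → E2 → ℝ) (CV : ℝ)
    (hVb : ∀ (r : ℝ) (v : E2), |V' r v| ≤ CV)
    (LV : ℝ) (hVLip : ∀ (r r' : ℝ) (v : E2), |V' r v - V' r' v| ≤ LV * |r - r'|) :
    ∃ C : ℝ, 0 < C ∧ ∀ N : ℕ, 1 ≤ N → ∀ (x y v : E2),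
      ‖forceN V' HR Ht θ N (x, v) - forceN V' HR Ht θ N (y, v)‖
        ≤ (if (N : ℝ) ^ (-θ) ≤ ‖x‖ then C * ‖x‖⁻¹ + C else C * (N : ℝ) ^ θ) * ‖x - y‖ := by
  obtain ⟨B₁, hB₁, hHRb⟩ := exists_abs_le_of_continuous_of_eq_off_Icc hHRs.continuous hHR1 hHR0
  obtain ⟨B₂, hB₂, hHtb⟩ := exists_abs_le_of_continuous_of_eq_off_Icc hHts.continuous hHt1 hHt0
  obtain ⟨K, hK, hHRLip⟩ := exists_lipschitz_of_contDiff_of_eq_off_Icc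
    (hHRs.of_le (by exact_mod_cast le_top)) hHR1 hHR0
  have hCV : 0 ≤ CV := (abs_nonneg _).trans (hVb 0 0)
  have hLV : 0 ≤ LV := by
    have := (abs_nonneg _).trans (hVLip 1 0 0)
    simpa using this
  set B := CV * (B₁ * B₂) with hBdef
  set L := (LV * B₁ + CV * K) * B₂ with hLdef
  have hB : 0 ≤ B := by positivity
  have hL : 0 ≤ L := by positivity
  refine ⟨2 * B + L + 1, by positivity, fun N hN x y v => ?_⟩
  have hN1 : (1 : ℝ) ≤ N := by exact_mod_cast hN
  have hM : (1 : ℝ) ≤ (N : ℝ) ^ θ := Real.one_le_rpow hN1 hθ.le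
  have hδ : 0 < (N : ℝ) ^ (-θ) := Real.rpow_pos_of_pos (by linarith) _
  have hg : |V' ‖x‖ v * (HR ‖x‖ * Ht ‖v‖)| ≤ B := by
    rw [abs_mul, abs_mul, hBdef]
    gcongr
    exacts [hVb _ _, hHRb _, hHtb _]
  have hgLip : |V' ‖x‖ v * (HR ‖x‖ * Ht ‖v‖) - V' ‖y‖ v * (HR ‖y‖ * Ht ‖v‖)|
      ≤ L * ‖x - y‖ := by
    have hsplit : V' ‖x‖ v * (HR ‖x‖ * Ht ‖v‖) - V' ‖y‖ v * (HR ‖y‖ * Ht ‖v‖) =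
        ((V' ‖x‖ v - V' ‖y‖ v) * HR ‖x‖ + V' ‖y‖ v * (HR ‖x‖ - HR ‖y‖)) * Ht ‖v‖ := by ring
    have hxy : |‖x‖ - ‖y‖| ≤ ‖x - y‖ := abs_norm_sub_norm_le x y
    calc _ ≤ (|V' ‖x‖ v - V' ‖y‖ v| * |HR ‖x‖| + |V' ‖y‖ v| * |HR ‖x‖ - HR ‖y‖|) * |Ht ‖v‖| := by
          rw [hsplit, abs_mul]
          gcongr
          exact (abs_add_le _ _).trans_eq (by rw [abs_mul, abs_mul])
      _ ≤ (LV * ‖x - y‖ * B₁ + CV * (K * ‖x - y‖)) * B₂ := by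
          gcongr
          exacts [(hVLip _ _ _).trans (by gcongr), hHRb _, hVb _ _,
            (hHRLip _ _).trans (by gcongr), hHtb _]
      _ = L * ‖x - y‖ := by rw [hLdef]; ring
  have hdir : ‖(max ‖y‖ ((N : ℝ) ^ (-θ)))⁻¹ • y‖ ≤ 1 := by
    have hy : 0 < max ‖y‖ ((N : ℝ) ^ (-θ)) := lt_max_of_lt_right hδ
    rw [norm_smul, norm_inv, Real.norm_eq_abs, abs_of_pos hy, inv_mul_le_one₀ hy]
    exact le_max_left _ _
  have hmain : ‖forceN V' HR Ht θ N (x, v) - forceN V' HR Ht θ N (y, v)‖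
      ≤ (2 * B * (max ‖x‖ ((N : ℝ) ^ (-θ)))⁻¹ + L) * ‖x - y‖ := by
    have hφ := norm_inv_max_smul_sub_le hδ x y
    rw [forceN_eq_smul, forceN_eq_smul]
    generalize V' ‖x‖ v * (HR ‖x‖ * Ht ‖v‖) = g at *
    generalize V' ‖y‖ v * (HR ‖y‖ * Ht ‖v‖) = g' at *
    generalize (max ‖y‖ ((N : ℝ) ^ (-θ)))⁻¹ • y = w at *
    generalize (max ‖x‖ ((N : ℝ) ^ (-θ)))⁻¹ = m at *
    have hsplit : g • (m • x) - g' • w = g • (m • x - w) + (g - g') • w := by module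
    calc _ ≤ |g| * ‖m • x - w‖ + |g - g'| * ‖w‖ := by
          rw [hsplit]
          refine (norm_add_le _ _).trans_eq ?_
          rw [norm_smul, norm_smul, Real.norm_eq_abs, Real.norm_eq_abs]
      _ ≤ B * (2 * m * ‖x - y‖) + L * ‖x - y‖ * 1 := by gcongr
      _ = _ := by ring
  refine hmain.trans (mul_le_mul_of_nonneg_right ?_ (norm_nonneg _))
  split_ifs with h
  · rw [max_eq_left h]
    have : 0 ≤ ‖x‖⁻¹ := inv_nonneg.2 (norm_nonneg x)
    nlinarith [mul_nonneg hL this]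
  · rw [max_eq_right (not_le.1 h).le, Real.rpow_neg N.cast_nonneg, inv_inv]
    nlinarith [mul_le_mul_of_nonneg_left hM hL]
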